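/- arXiv:1810.03158 — 9 statements merged into one kernel-verified Lean document; each statement's English description precedes it below -/
import Mathlib

section
/- Let A1, A2, A3, A4, A5 be real numbers and H(X) = X^5 + A1·X^4 + A2·X^3 + A3·X^2 + A4·X + A5. If (A3 − A1·A2)·(A2·A5 − A3·A4) − (A5 − A1·A4)^2 = 0 and A3 − A1·A2 ≠ 0, then, setting θ = (A5 − A1·A4)/(A3 − A1·A2), one has A4 = θ·(A2 − θ) and A5 = θ·(A3 − A1·θ), and consequently H factorizes in ℝ[X] as H(X) = (X^2 + θ)·(X^3 + A1·X^2 + (A2 − θ)·X + (A3 − A1·θ)); in particular X^2 + θ divides H. -/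
open Polynomial

theorem stmt_0 (A1 A2 A3 A4 A5 : ℝ)
    (hΔ : (A3 - A1 * A2) * (A2 * A5 - A3 * A4) - (A5 - A1 * A4) ^ 2 = 0)
    (hne : A3 - A1 * A2 ≠ 0) :
    A4 = (A5 - A1 * A4) / (A3 - A1 * A2) * (A2 - (A5 - A1 * A4) / (A3 - A1 * A2)) ∧
    A5 = (A5 - A1 * A4) / (A3 - A1 * A2) *
        (A3 - A1 * ((A5 - A1 * A4) / (A3 - A1 * A2))) ∧
    (X ^ 5 + C A1 * X ^ 4 + C A2 * X ^ 3 + C A3 * X ^ 2 + C A4 * X + C A5 : ℝ[X]) =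
      (X ^ 2 + C ((A5 - A1 * A4) / (A3 - A1 * A2))) *
        (X ^ 3 + C A1 * X ^ 2 + C (A2 - (A5 - A1 * A4) / (A3 - A1 * A2)) * X +
          C (A3 - A1 * ((A5 - A1 * A4) / (A3 - A1 * A2)))) ∧
    (X ^ 2 + C ((A5 - A1 * A4) / (A3 - A1 * A2))) ∣
      (X ^ 5 + C A1 * X ^ 4 + C A2 * X ^ 3 + C A3 * X ^ 2 + C A4 * X + C A5 : ℝ[X]) := by
  have hθ : (A5 - A1 * A4) / (A3 - A1 * A2) * (A3 - A1 * A2) = A5 - A1 * A4 :=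
    div_mul_cancel₀ _ hne
  generalize (A5 - A1 * A4) / (A3 - A1 * A2) = θ at hθ ⊢
  have h4 : A4 = θ * (A2 - θ) := by
    apply mul_left_cancel₀ (pow_ne_zero 2 hne)
    rw [← hθ] at hΔ
    linear_combination (-1) * hΔ - A2 * (A3 - A1 * A2) * hθ
  have h5 : A5 = θ * (A3 - A1 * θ) := by
    linear_combination A1 * h4 - hθ
  have hH : (X ^ 5 + C A1 * X ^ 4 + C A2 * X ^ 3 + C A3 * X ^ 2 + C A4 * X + C A5 : ℝ[X]) =
      (X ^ 2 + C θ) * (X ^ 3 + C A1 * X ^ 2 + C (A2 - θ) * X + C (A3 - A1 * θ)) := by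
    have c4 := congrArg (C : ℝ → ℝ[X]) h4
    have c5 := congrArg (C : ℝ → ℝ[X]) h5
    simp only [C_mul, C_sub] at c4 c5 ⊢
    linear_combination X * c4 + c5
  exact ⟨h4, h5, hH, hH ▸ dvd_mul_right _ _⟩
end

section
/- Let A1, A2, A3, A4, A5 be real numbers and H(X) = X^5 + A1·X^4 + A2·X^3 + A3·X^2 + A4·X + A5. If X^2 + θ divides H in ℝ[X] for some real number θ, then A4 = θ·(A2 − θ), A5 = θ·(A3 − A1·θ), A5 − A1·A4 = θ·(A3 − A1·A2), A2·A5 − A3·A4 = θ^2·(A3 − A1·A2), and consequently Δ4 = (A3 − A1·A2)·(A2·A5 − A3·A4) − (A5 − A1·A4)^2 = 0. -/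
open Polynomial

theorem stmt_1 (A1 A2 A3 A4 A5 θ : ℝ)
    (hdvd : (X ^ 2 + C θ) ∣
      (X ^ 5 + C A1 * X ^ 4 + C A2 * X ^ 3 + C A3 * X ^ 2 + C A4 * X + C A5 : ℝ[X])) :
    A4 = θ * (A2 - θ) ∧
    A5 = θ * (A3 - A1 * θ) ∧
    A5 - A1 * A4 = θ * (A3 - A1 * A2) ∧
    A2 * A5 - A3 * A4 = θ ^ 2 * (A3 - A1 * A2) ∧
    (A3 - A1 * A2) * (A2 * A5 - A3 * A4) - (A5 - A1 * A4) ^ 2 = 0 := by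
  have h1 : (X ^ 2 + C θ : ℝ[X]) ∣ C (A4 - θ * (A2 - θ)) * X + C (A5 - θ * (A3 - A1 * θ)) := by
    have h2 := dvd_sub hdvd (Dvd.intro
      (X ^ 3 + C A1 * X ^ 2 + C (A2 - θ) * X + C (A3 - A1 * θ)) rfl)
    convert h2 using 1
    simp only [C_sub, C_mul]
    ring
  have h0 := eq_zero_of_dvd_of_degree_lt h1 (by
    rw [degree_X_pow_add_C (by norm_num)]
    exact lt_of_le_of_lt degree_linear_le (by norm_num))
  have ha := congrArg (fun p => coeff p 1) h0
  have hb := congrArg (fun p => coeff p 0) h0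
  simp only [coeff_add, coeff_C_mul, coeff_X_one, coeff_X_zero, coeff_C_zero, coeff_zero,
    coeff_C_succ, mul_one, mul_zero, zero_add, add_zero] at ha hb
  have e4 : A4 = θ * (A2 - θ) := by linarith
  have e5 : A5 = θ * (A3 - A1 * θ) := by linarith
  refine ⟨e4, e5, ?_, ?_, ?_⟩ <;> rw [e4, e5] <;> ring
end

section
/- Let A1, A2, A3, A4, A5 be real numbers and H(X) = X^5 + A1·X^4 + A2·X^3 + A3·X^2 + A4·X + A5, regarded as a polynomial over ℂ. Suppose (A3 − A1·A2)·(A2·A5 − A3·A4) − (A5 − A1·A4)^2 = 0, A3 − A1·A2 ≠ 0, θ1 := (A5 − A1·A4)/(A3 − A1·A2) > 0, and A3 − A1·θ1 ≠ 0. Then H has exactly one pair of purely imaginary roots, namely ±i·√θ1, and every other complex root of H has nonzero real part. -/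
open Polynomial Complex

theorem stmt_2 (A1 A2 A3 A4 A5 : ℝ)
    (hΔ : (A3 - A1 * A2) * (A2 * A5 - A3 * A4) - (A5 - A1 * A4) ^ 2 = 0)
    (hne : A3 - A1 * A2 ≠ 0)
    (hθ : (A5 - A1 * A4) / (A3 - A1 * A2) > 0)
    (hne2 : A3 - A1 * ((A5 - A1 * A4) / (A3 - A1 * A2)) ≠ 0) :
    (X ^ 5 + C (A1 : ℂ) * X ^ 4 + C (A2 : ℂ) * X ^ 3 + C (A3 : ℂ) * X ^ 2 +
        C (A4 : ℂ) * X + C (A5 : ℂ)).IsRoot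
      (Complex.I * Real.sqrt ((A5 - A1 * A4) / (A3 - A1 * A2))) ∧
    (X ^ 5 + C (A1 : ℂ) * X ^ 4 + C (A2 : ℂ) * X ^ 3 + C (A3 : ℂ) * X ^ 2 +
        C (A4 : ℂ) * X + C (A5 : ℂ)).IsRoot
      (-(Complex.I * Real.sqrt ((A5 - A1 * A4) / (A3 - A1 * A2)))) ∧
    ∀ z : ℂ,
      (X ^ 5 + C (A1 : ℂ) * X ^ 4 + C (A2 : ℂ) * X ^ 3 + C (A3 : ℂ) * X ^ 2 +
          C (A4 : ℂ) * X + C (A5 : ℂ)).IsRoot z →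
        z.re = 0 →
        z = Complex.I * Real.sqrt ((A5 - A1 * A4) / (A3 - A1 * A2)) ∨
        z = -(Complex.I * Real.sqrt ((A5 - A1 * A4) / (A3 - A1 * A2))) := by
  generalize hT : (A5 - A1 * A4) / (A3 - A1 * A2) = t at *
  have hD : t * (A3 - A1 * A2) = A5 - A1 * A4 := by
    rw [← hT]; field_simp
  have h1 : t ^ 2 - A2 * t + A4 = 0 := by
    have h : (A3 - A1 * A2) ^ 2 * (t ^ 2 - A2 * t + A4) = 0 := by
      linear_combination (t * (A3 - A1 * A2) + (A5 - A1 * A4) - A2 * (A3 - A1 * A2)) * hD - hΔ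
    exact (mul_eq_zero.mp h).resolve_left (pow_ne_zero 2 hne)
  have h2 : A1 * t ^ 2 - A3 * t + A5 = 0 := by
    linear_combination A1 * h1 - hD
  have hs : (Real.sqrt t) ^ 2 = t := Real.sq_sqrt hθ.le
  generalize Real.sqrt t = s at *
  have c1 : (s : ℂ) ^ 4 - A2 * s ^ 2 + A4 = 0 := by
    rw [← hs] at h1
    have := congrArg (fun x : ℝ => (x : ℂ)) h1
    push_cast at this
    linear_combination this
  have c2 : A1 * (s : ℂ) ^ 4 - A3 * s ^ 2 + A5 = 0 := by
    rw [← hs] at h2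
    have := congrArg (fun x : ℝ => (x : ℂ)) h2
    push_cast at this
    linear_combination this
  have key : ∀ y : ℂ, (I * y) ^ 5 + A1 * (I * y) ^ 4 + A2 * (I * y) ^ 3 + A3 * (I * y) ^ 2 +
      A4 * (I * y) + A5 = (A1 * y ^ 4 - A3 * y ^ 2 + A5) + y * (y ^ 4 - A2 * y ^ 2 + A4) * I := by
    intro y
    have e2 : I ^ 2 = -1 := I_sq
    have e3 : I ^ 3 = -I := I_pow_three
    have e4 : I ^ 4 = 1 := I_pow_four
    have e5 : I ^ 5 = I := by rw [pow_succ, e4, one_mul]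
    simp only [mul_pow, e2, e3, e4, e5]
    ring
  refine ⟨?_, ?_, ?_⟩
  · simp only [IsRoot.def, eval_add, eval_mul, eval_pow, eval_X, eval_C]
    rw [key, c1, c2]; ring
  · simp only [IsRoot.def, eval_add, eval_mul, eval_pow, eval_X, eval_C]
    rw [← mul_neg, key]
    linear_combination c2 - s * I * c1
  · intro z hz hre
    obtain ⟨y, rfl⟩ : ∃ y : ℝ, z = I * y := ⟨z.im, by apply Complex.ext <;> simp [hre]⟩
    simp only [IsRoot.def, eval_add, eval_mul, eval_pow, eval_X, eval_C] at hz
    rw [key] at hz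
    have hz' : ((A1 * y ^ 4 - A3 * y ^ 2 + A5 : ℝ) : ℂ) +
        ((y * (y ^ 4 - A2 * y ^ 2 + A4) : ℝ) : ℂ) * I = 0 := by
      push_cast; exact hz
    have hr : A1 * y ^ 4 - A3 * y ^ 2 + A5 = 0 := by
      have h := congrArg Complex.re hz'
      simpa only [add_re, mul_I_re, ofReal_re, ofReal_im, neg_zero, add_zero, zero_re] using h
    have hi : y * (y ^ 4 - A2 * y ^ 2 + A4) = 0 := by
      have h := congrArg Complex.im hz'
      simpa only [add_im, mul_I_im, ofReal_re, ofReal_im, zero_add, zero_im] using h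
    rcases mul_eq_zero.mp hi with h0 | h0
    · exfalso
      subst h0
      have h5 : A5 = 0 := by linear_combination hr
      apply hne2
      have : t * (A3 - A1 * t) = 0 := by linear_combination h5 - h2
      exact (mul_eq_zero.mp this).resolve_left hθ.ne'
    · have h : (A3 - A1 * A2) * (y ^ 2 - s ^ 2) = 0 := by
        linear_combination A1 * h0 - hr - hD - (A3 - A1 * A2) * hs
      have h' := (mul_eq_zero.mp h).resolve_left hne
      rcases sq_eq_sq_iff_eq_or_eq_neg.mp (sub_eq_zero.mp h') with e | e
      · left; rw [e]
      · right; rw [e]; push_cast; ring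
end

section
/- Let A1, A2, A3, A4, A5 be real numbers with A5 = A1·A4, A3 = A1·A2, A4 < 0, and A1 ≠ 0, and let H(X) = X^5 + A1·X^4 + A2·X^3 + A3·X^2 + A4·X + A5. Then H(X) = (X + A1)·(X^4 + A2·X^2 + A4), and setting θ2 = (A2 + √(A2^2 − 4·A4))/2 and θ3 = (A2 − √(A2^2 − 4·A4))/2, one has θ2 > 0 and θ3 < 0, and the complex roots of H are exactly: the purely imaginary pair ±i·√θ2, the nonzero real pair ±√(−θ3), and the nonzero real root −A1. In particular H has exactly one pair of purely imaginary roots and every other root has nonzero real part. -/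
open Polynomial Complex

theorem stmt_3 (A1 A2 A3 A4 A5 : ℝ)
    (h5 : A5 = A1 * A4) (h3 : A3 = A1 * A2) (h4 : A4 < 0) (h1 : A1 ≠ 0) :
    (X ^ 5 + C (A1 : ℂ) * X ^ 4 + C (A2 : ℂ) * X ^ 3 + C (A3 : ℂ) * X ^ 2 +
        C (A4 : ℂ) * X + C (A5 : ℂ)) =
      (X + C (A1 : ℂ)) * (X ^ 4 + C (A2 : ℂ) * X ^ 2 + C (A4 : ℂ)) ∧
    (A2 + Real.sqrt (A2 ^ 2 - 4 * A4)) / 2 > 0 ∧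
    (A2 - Real.sqrt (A2 ^ 2 - 4 * A4)) / 2 < 0 ∧
    (∀ z : ℂ,
      (X ^ 5 + C (A1 : ℂ) * X ^ 4 + C (A2 : ℂ) * X ^ 3 + C (A3 : ℂ) * X ^ 2 +
          C (A4 : ℂ) * X + C (A5 : ℂ)).IsRoot z ↔
        z = Complex.I * Real.sqrt ((A2 + Real.sqrt (A2 ^ 2 - 4 * A4)) / 2) ∨
        z = -(Complex.I * Real.sqrt ((A2 + Real.sqrt (A2 ^ 2 - 4 * A4)) / 2)) ∨
        z = Real.sqrt (-((A2 - Real.sqrt (A2 ^ 2 - 4 * A4)) / 2)) ∨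
        z = -(Real.sqrt (-((A2 - Real.sqrt (A2 ^ 2 - 4 * A4)) / 2)) : ℂ) ∨
        z = -(A1 : ℂ)) ∧
    (∀ z : ℂ,
      (X ^ 5 + C (A1 : ℂ) * X ^ 4 + C (A2 : ℂ) * X ^ 3 + C (A3 : ℂ) * X ^ 2 +
          C (A4 : ℂ) * X + C (A5 : ℂ)).IsRoot z →
        z.re = 0 →
        z = Complex.I * Real.sqrt ((A2 + Real.sqrt (A2 ^ 2 - 4 * A4)) / 2) ∨
        z = -(Complex.I * Real.sqrt ((A2 + Real.sqrt (A2 ^ 2 - 4 * A4)) / 2))) := by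
  have hs2 : Real.sqrt (A2 ^ 2 - 4 * A4) ^ 2 = A2 ^ 2 - 4 * A4 :=
    Real.sq_sqrt (by nlinarith [sq_nonneg A2])
  have hs0 : 0 ≤ Real.sqrt (A2 ^ 2 - 4 * A4) := Real.sqrt_nonneg _
  generalize Real.sqrt (A2 ^ 2 - 4 * A4) = s at hs2 hs0 ⊢
  have hlt : |A2| < s := abs_lt_of_sq_lt_sq (by linarith) hs0
  have hl := abs_lt.mp hlt
  have ht2 : (A2 + s) / 2 > 0 := by linarith [hl.1]
  have ht3 : (A2 - s) / 2 < 0 := by linarith [hl.2]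
  have hp2 : Real.sqrt ((A2 + s) / 2) ^ 2 = (A2 + s) / 2 := Real.sq_sqrt ht2.le
  have hq2 : Real.sqrt (-((A2 - s) / 2)) ^ 2 = -((A2 - s) / 2) := Real.sq_sqrt (by linarith)
  have hq0 : 0 < Real.sqrt (-((A2 - s) / 2)) := Real.sqrt_pos.mpr (by linarith)
  generalize Real.sqrt ((A2 + s) / 2) = p at hp2 ⊢
  generalize Real.sqrt (-((A2 - s) / 2)) = q at hq2 hq0 ⊢
  have hA2 : A2 = p ^ 2 - q ^ 2 := by linarith
  have hs : s = p ^ 2 + q ^ 2 := by linarith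
  have hA4 : A4 = -(p ^ 2 * q ^ 2) := by
    rw [hs, hA2] at hs2
    linarith
  have key : ∀ z : ℂ,
      (X ^ 5 + C (A1 : ℂ) * X ^ 4 + C (A2 : ℂ) * X ^ 3 + C (A3 : ℂ) * X ^ 2 +
          C (A4 : ℂ) * X + C (A5 : ℂ)).IsRoot z ↔
        z = Complex.I * p ∨ z = -(Complex.I * p) ∨ z = q ∨ z = -(q : ℂ) ∨ z = -(A1 : ℂ) := by
    intro z
    have hf : (X ^ 5 + C (A1 : ℂ) * X ^ 4 + C (A2 : ℂ) * X ^ 3 + C (A3 : ℂ) * X ^ 2 +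
          C (A4 : ℂ) * X + C (A5 : ℂ)).eval z =
        (z - Complex.I * p) * ((z + Complex.I * p) * ((z - q) * ((z + q) * (z + A1)))) := by
      simp only [eval_add, eval_mul, eval_pow, eval_X, eval_C]
      rw [h5, h3, hA4, hA2]
      push_cast
      linear_combination ((p : ℂ) ^ 2 * (z ^ 2 - q ^ 2) * (z + A1)) * Complex.I_sq
    rw [IsRoot.def, hf]
    simp only [mul_eq_zero, sub_eq_zero, add_eq_zero_iff_eq_neg]
  refine ⟨?_, ht2, ht3, key, ?_⟩
  · rw [h5, h3]
    simp only [ofReal_mul, C_mul]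
    ring
  · intro z hz hre
    rcases (key z).mp hz with h | h | h | h | h
    · exact Or.inl h
    · exact Or.inr h
    · rw [h] at hre
      simp at hre
      exact absurd hre hq0.ne'
    · rw [h] at hre
      simp at hre
      exact absurd hre hq0.ne'
    · rw [h] at hre
      simp at hre
      exact absurd hre h1
end

section
/- Let ξ1, ξ2, ξ3, ξ4, ξ5 be complex numbers and define A1, A2, A3, A4, A5 by the identity ∏_{i=1}^{5}(X − ξi) = X^5 + A1·X^4 + A2·X^3 + A3·X^2 + A4·X + A5 (so A1 = −e1, A2 = e2, A3 = −e3, A4 = e4, A5 = −e5, where ek denotes the k-th elementary symmetric polynomial of ξ1,…,ξ5). Then (A3 − A1·A2)·(A2·A5 − A3·A4) − (A5 − A1·A4)^2 = ∏_{1 ≤ i < j ≤ 5} (ξi + ξj), the product of the ten pairwise sums of the roots. -/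
open Polynomial

theorem stmt_5 (ξ1 ξ2 ξ3 ξ4 ξ5 A1 A2 A3 A4 A5 : ℂ)
    (hfact : (X - C ξ1) * (X - C ξ2) * (X - C ξ3) * (X - C ξ4) * (X - C ξ5) =
      X ^ 5 + C A1 * X ^ 4 + C A2 * X ^ 3 + C A3 * X ^ 2 + C A4 * X + C A5) :
    (A3 - A1 * A2) * (A2 * A5 - A3 * A4) - (A5 - A1 * A4) ^ 2 =
      (ξ1 + ξ2) * (ξ1 + ξ3) * (ξ1 + ξ4) * (ξ1 + ξ5) * (ξ2 + ξ3) * (ξ2 + ξ4) *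
        (ξ2 + ξ5) * (ξ3 + ξ4) * (ξ3 + ξ5) * (ξ4 + ξ5) := by
  have h : (X - C ξ1) * (X - C ξ2) * (X - C ξ3) * (X - C ξ4) * (X - C ξ5) =
      X ^ 5 + C (-(ξ1 + ξ2 + ξ3 + ξ4 + ξ5)) * X ^ 4 + C ((ξ1*ξ2 + ξ1*ξ3 + ξ1*ξ4 + ξ1*ξ5 + ξ2*ξ3 + ξ2*ξ4 + ξ2*ξ5 + ξ3*ξ4 + ξ3*ξ5 + ξ4*ξ5)) * X ^ 3 + C (-(ξ1*ξ2*ξ3 + ξ1*ξ2*ξ4 + ξ1*ξ2*ξ5 + ξ1*ξ3*ξ4 + ξ1*ξ3*ξ5 + ξ1*ξ4*ξ5 + ξ2*ξ3*ξ4 + ξ2*ξ3*ξ5 + ξ2*ξ4*ξ5 + ξ3*ξ4*ξ5)) * X ^ 2 + C ((ξ1*ξ2*ξ3*ξ4 + ξ1*ξ2*ξ3*ξ5 + ξ1*ξ2*ξ4*ξ5 + ξ1*ξ3*ξ4*ξ5 + ξ2*ξ3*ξ4*ξ5)) * X + C (-(ξ1*ξ2*ξ3*ξ4*ξ5)) :=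 by
    simp only [map_add, map_mul, map_neg]
    ring
  rw [h] at hfact
  have h1 : -(ξ1 + ξ2 + ξ3 + ξ4 + ξ5) = A1 := by
    simpa [coeff_X, coeff_C, coeff_X_pow, -map_add, -map_mul, -map_neg, -C_add, -C_mul, -C_neg] using congrArg (fun p => coeff p 4) hfact
  have h2 : (ξ1*ξ2 + ξ1*ξ3 + ξ1*ξ4 + ξ1*ξ5 + ξ2*ξ3 + ξ2*ξ4 + ξ2*ξ5 + ξ3*ξ4 + ξ3*ξ5 + ξ4*ξ5) = A2 := by
    simpa [coeff_X, coeff_C, coeff_X_pow, -map_add, -map_mul, -map_neg, -C_add, -C_mul, -C_neg] using congrArg (fun p => coeff p 3) hfact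
  have h3 : -(ξ1*ξ2*ξ3 + ξ1*ξ2*ξ4 + ξ1*ξ2*ξ5 + ξ1*ξ3*ξ4 + ξ1*ξ3*ξ5 + ξ1*ξ4*ξ5 + ξ2*ξ3*ξ4 + ξ2*ξ3*ξ5 + ξ2*ξ4*ξ5 + ξ3*ξ4*ξ5) = A3 := by
    simpa [coeff_X, coeff_C, coeff_X_pow, -map_add, -map_mul, -map_neg, -C_add, -C_mul, -C_neg] using congrArg (fun p => coeff p 2) hfact
  have h4 : (ξ1*ξ2*ξ3*ξ4 + ξ1*ξ2*ξ3*ξ5 + ξ1*ξ2*ξ4*ξ5 + ξ1*ξ3*ξ4*ξ5 + ξ2*ξ3*ξ4*ξ5) = A4 := by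
    simpa [coeff_X, coeff_C, coeff_X_pow, -map_add, -map_mul, -map_neg, -C_add, -C_mul, -C_neg] using congrArg (fun p => coeff p 1) hfact
  have h5 : -(ξ1*ξ2*ξ3*ξ4*ξ5) = A5 := by
    simpa [coeff_X, coeff_C, coeff_X_pow, -map_add, -map_mul, -map_neg, -C_add, -C_mul, -C_neg] using congrArg (fun p => coeff p 0) hfact
  rw [← h1, ← h2, ← h3, ← h4, ← h5]
  ring
end

section
/- Let α, m, q, Λ be positive real numbers with Λ/(m·q) < 1. Then every complex root of the cubic polynomial X^3 + (α + m + q)·X^2 + (α·q + α·m + m·q)·X + α·(m·q − Λ) has negative real part. -/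
theorem stmt_7 (α m q Λ : ℝ)
    (hα : α > 0) (hm : m > 0) (hq : q > 0) (hΛ : Λ > 0)
    (hR0 : Λ / (m * q) < 1) :
    ∀ z : ℂ,
      z ^ 3 + ((α + m + q : ℝ) : ℂ) * z ^ 2 + ((α * q + α * m + m * q : ℝ) : ℂ) * z +
          ((α * (m * q - Λ) : ℝ) : ℂ) = 0 →
        z.re < 0 := by
  intro z hz
  by_contra hre
  have hre : 0 ≤ z.re := not_lt.mp hre
  have hL : Λ < m * q := by
    rwa [div_lt_one (by positivity)] at hR0
  have key : ∀ a : ℝ, a ≤ ‖z + (a : ℂ)‖ := by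
    intro a
    have h := Complex.re_le_norm (z + (a : ℂ))
    simp only [Complex.add_re, Complex.ofReal_re] at h
    linarith
  have hprod : (z + (α : ℂ)) * ((z + (m : ℂ)) * (z + (q : ℂ))) = ((α * Λ : ℝ) : ℂ) := by
    push_cast at hz ⊢
    linear_combination hz
  have hn := congrArg norm hprod
  rw [norm_mul, norm_mul, Complex.norm_real, Real.norm_of_nonneg (by positivity)] at hn
  have h1 : m * q ≤ ‖z + (m : ℂ)‖ * ‖z + (q : ℂ)‖ :=
    mul_le_mul (key m) (key q) hq.le (norm_nonneg _)
  have h2 : α * (m * q) ≤ ‖z + (α : ℂ)‖ * (‖z + (m : ℂ)‖ * ‖z + (q : ℂ)‖) :=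
    mul_le_mul (key α) h1 (by positivity) (norm_nonneg _)
  have h3 : α * Λ < α * (m * q) := mul_lt_mul_of_pos_left hL hα
  linarith
end

section
/- Let α, m, q, Λ be positive real numbers and let c(X) = X^3 + (α + m + q)·X^2 + (α·q + α·m + m·q)·X + α·(m·q − Λ). If Λ/(m·q) > 1, then c has a real root that is strictly positive. If Λ = m·q, then 0 is a root of c and the other two complex roots of c have negative real parts. -/
theorem stmt_8 (α m q Λ : ℝ)
    (hα : α > 0) (hm : m > 0) (hq : q > 0) (hΛ : Λ > 0) :
    (Λ / (m * q) > 1 →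
      ∃ x : ℝ, x > 0 ∧
        x ^ 3 + (α + m + q) * x ^ 2 + (α * q + α * m + m * q) * x +
          α * (m * q - Λ) = 0) ∧
    (Λ = m * q →
      ((0 : ℝ) ^ 3 + (α + m + q) * (0 : ℝ) ^ 2 + (α * q + α * m + m * q) * (0 : ℝ) +
          α * (m * q - Λ) = 0) ∧
      ∀ z : ℂ,
        z ^ 3 + ((α + m + q : ℝ) : ℂ) * z ^ 2 + ((α * q + α * m + m * q : ℝ) : ℂ) * z +
            ((α * (m * q - Λ) : ℝ) : ℂ) = 0 →
          z ≠ 0 → z.re < 0) := by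
  have hB : 0 < α * q + α * m + m * q := by positivity
  have hA : 0 < α + m + q := by positivity
  refine ⟨fun h => ?_, fun h => ⟨by rw [h]; ring, fun z hz hz0 => ?_⟩⟩
  · have hmq : 0 < m * q := by positivity
    have h1 : m * q < Λ := by
      have := (lt_div_iff₀ hmq).1 h
      linarith
    have h0 : α * (m * q - Λ) < 0 := mul_neg_of_pos_of_neg hα (by linarith)
    generalize hM : α * Λ / (α * q + α * m + m * q) = M
    have hM0 : 0 < M := by rw [← hM]; positivity
    have hBM : (α * q + α * m + m * q) * M = α * Λ := by
      rw [← hM]; field_simp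
    have hc : ContinuousOn (fun x : ℝ => x ^ 3 + (α + m + q) * x ^ 2
        + (α * q + α * m + m * q) * x + α * (m * q - Λ)) (Set.Icc 0 M) := by fun_prop
    have hfM : 0 ≤ M ^ 3 + (α + m + q) * M ^ 2
        + (α * q + α * m + m * q) * M + α * (m * q - Λ) := by
      rw [hBM]
      have e : M ^ 3 + (α + m + q) * M ^ 2 + α * Λ + α * (m * q - Λ)
        = M ^ 3 + (α + m + q) * M ^ 2 + α * (m * q) := by ring
      rw [e]; positivity
    obtain ⟨x, hx, hx0⟩ := intermediate_value_Icc hM0.le hc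
      (show (0 : ℝ) ∈ Set.Icc _ _ from ⟨by simpa using h0.le, hfM⟩)
    refine ⟨x, lt_of_le_of_ne hx.1 ?_, hx0⟩
    rintro rfl
    simp only at hx0
    nlinarith
  · generalize α + m + q = A at *
    generalize α * q + α * m + m * q = B at *
    have hq2 : z * z + (A : ℂ) * z + (B : ℂ) = 0 := by
      apply mul_left_cancel₀ hz0
      rw [h] at hz
      simp only [sub_self, mul_zero, Complex.ofReal_zero] at hz
      linear_combination hz
    have hre := congrArg Complex.re hq2
    have him := congrArg Complex.im hq2
    simp at hre him
    by_contra! hx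
    have hy : z.im * (2 * z.re + A) = 0 := by linarith
    rcases mul_eq_zero.1 hy with hy | hy
    · rw [hy] at hre
      nlinarith [mul_nonneg hA.le hx, mul_nonneg hx hx]
    · linarith
end

section
/- Fix positive real numbers b, K, λ0, m, η, τ and ε > 0, nonnegative μ, ρ, k4, and 0 ≤ k3 < 1. Define for ω0 ≥ 0 the function R0(ω0) = (b·K·(τ + ω0)·λ0)/(m·(η·τ + ω0·(ε + η))) · 1/(1 − k3·exp(−k4·(μ·τ + (μ + ρ)·ω0)/(ω0 + τ))). Then R0 is strictly decreasing on [0, ∞). -/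
theorem stmt_12 (b K lam0 m η τ ε μ ρ k3 k4 : ℝ)
    (hb : b > 0) (hK : K > 0) (hlam0 : lam0 > 0) (hm : m > 0) (hη : η > 0)
    (hτ : τ > 0) (hε : ε > 0) (hμ : μ ≥ 0) (hρ : ρ ≥ 0) (hk4 : k4 ≥ 0)
    (hk3 : 0 ≤ k3) (hk3' : k3 < 1) :
    StrictAntiOn
      (fun ω0 : ℝ =>
        b * K * (τ + ω0) * lam0 / (m * (η * τ + ω0 * (ε + η))) *
          (1 / (1 - k3 * Real.exp (-(k4 * (μ * τ + (μ + ρ) * ω0) / (ω0 + τ))))))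
      (Set.Ici (0 : ℝ)) := by
  intro x hx y hy hxy
  have hx0 : 0 ≤ x := hx
  have hy0 : 0 ≤ y := hy
  have hd : 0 < y - x := sub_pos.mpr hxy
  have h1 : b * K * (τ + y) * lam0 / (m * (η * τ + y * (ε + η))) <
      b * K * (τ + x) * lam0 / (m * (η * τ + x * (ε + η))) := by
    rw [div_lt_div_iff₀ (by positivity) (by positivity)]
    have : 0 < b * K * lam0 * m * (τ * ε * (y - x)) := by positivity
    nlinarith [this]
  have h2 : k4 * (μ * τ + (μ + ρ) * x) / (x + τ) ≤ k4 * (μ * τ + (μ + ρ) * y) / (y + τ) := by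
    rw [div_le_div_iff₀ (by positivity) (by positivity)]
    have : 0 ≤ k4 * (τ * ρ * (y - x)) := by positivity
    nlinarith [this]
  have h0 : 0 ≤ k4 * (μ * τ + (μ + ρ) * x) / (x + τ) := by positivity
  have hE : Real.exp (-(k4 * (μ * τ + (μ + ρ) * y) / (y + τ))) ≤
      Real.exp (-(k4 * (μ * τ + (μ + ρ) * x) / (x + τ))) :=
    Real.exp_le_exp.mpr (neg_le_neg h2)
  have hE1 : Real.exp (-(k4 * (μ * τ + (μ + ρ) * x) / (x + τ))) ≤ 1 :=
    Real.exp_le_one_iff.mpr (neg_nonpos.mpr h0)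
  have hA := mul_le_mul_of_nonneg_left hE hk3
  have hB := mul_le_mul_of_nonneg_left hE1 hk3
  have hpx : 0 < 1 - k3 * Real.exp (-(k4 * (μ * τ + (μ + ρ) * x) / (x + τ))) := by linarith
  have hpy : 0 < 1 - k3 * Real.exp (-(k4 * (μ * τ + (μ + ρ) * y) / (y + τ))) := by linarith
  have h3 := one_div_le_one_div_of_le hpx (sub_le_sub_left hA 1)
  exact mul_lt_mul h1 h3 (one_div_pos.mpr hpy) (by positivity)
end

section
/- Fix positive real numbers b, K, λ0, m, η, τ and ε > 0, nonnegative μ, ρ, k4, and 0 ≤ k3 < 1. Define for ω0 ≥ 0 the function R0(ω0) = (b·K·(τ + ω0)·λ0)/(m·(η·τ + ω0·(ε + η))) · 1/(1 − k3·exp(−k4·(μ·τ + (μ + ρ)·ω0)/(ω0 + τ))), and R0^∞ = (b·K·λ0)/(m·(η + ε)) · 1/(1 − k3·exp(−k4·(μ + ρ))). Then R0(ω0) > R0^∞ for every ω0 ≥ 0. In particular, if R0^∞ ≥ 1, then R0(ω0) > 1 for all ω0 ≥ 0. -/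
theorem stmt_14 (b K lam0 m η τ ε μ ρ k3 k4 : ℝ)
    (hb : b > 0) (hK : K > 0) (hlam0 : lam0 > 0) (hm : m > 0) (hη : η > 0)
    (hτ : τ > 0) (hε : ε > 0) (hμ : μ ≥ 0) (hρ : ρ ≥ 0) (hk4 : k4 ≥ 0)
    (hk3 : 0 ≤ k3) (hk3' : k3 < 1) :
    (∀ ω0 : ℝ, ω0 ≥ 0 →
      b * K * (τ + ω0) * lam0 / (m * (η * τ + ω0 * (ε + η))) *
          (1 / (1 - k3 * Real.exp (-(k4 * (μ * τ + (μ + ρ) * ω0) / (ω0 + τ))))) >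
        b * K * lam0 / (m * (η + ε)) *
          (1 / (1 - k3 * Real.exp (-(k4 * (μ + ρ)))))) ∧
    (b * K * lam0 / (m * (η + ε)) * (1 / (1 - k3 * Real.exp (-(k4 * (μ + ρ))))) ≥ 1 →
      ∀ ω0 : ℝ, ω0 ≥ 0 →
        b * K * (τ + ω0) * lam0 / (m * (η * τ + ω0 * (ε + η))) *
            (1 / (1 - k3 * Real.exp (-(k4 * (μ * τ + (μ + ρ) * ω0) / (ω0 + τ))))) > 1) := by
  refine (fun h => ⟨h, fun h1 w hw => lt_of_le_of_lt h1 (h w hw)⟩) ?_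
  intro w hw
  have hwt : 0 < w + τ := by linarith
  have hx : k4 * (μ * τ + (μ + ρ) * w) / (w + τ) ≤ k4 * (μ + ρ) := by
    rw [div_le_iff₀ hwt]
    have : 0 ≤ k4 * (ρ * τ) := by positivity
    nlinarith
  have hx0 : 0 ≤ k4 * (μ * τ + (μ + ρ) * w) / (w + τ) := by positivity
  have hE : Real.exp (-(k4 * (μ + ρ))) ≤
      Real.exp (-(k4 * (μ * τ + (μ + ρ) * w) / (w + τ))) :=
    Real.exp_le_exp.mpr (by linarith)
  have hE1 : Real.exp (-(k4 * (μ * τ + (μ + ρ) * w) / (w + τ))) ≤ 1 :=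
    Real.exp_le_one_iff.mpr (by linarith)
  generalize Real.exp (-(k4 * (μ * τ + (μ + ρ) * w) / (w + τ))) = E at *
  generalize Real.exp (-(k4 * (μ + ρ))) = F at *
  have h1 : 0 < 1 - k3 * E := by nlinarith
  have h2 : 1 - k3 * E ≤ 1 - k3 * F := by nlinarith
  have h3 : b * K * lam0 / (m * (η + ε)) <
      b * K * (τ + w) * lam0 / (m * (η * τ + w * (ε + η))) := by
    rw [div_lt_div_iff₀ (by positivity) (by positivity)]
    have : 0 < b * K * lam0 * m * (ε * τ) := by positivity
    nlinarith
  have h4 : 1 / (1 - k3 * F) ≤ 1 / (1 - k3 * E) := one_div_le_one_div_of_le h1 h2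
  have h5 : 0 < 1 / (1 - k3 * F) := one_div_pos.mpr (by linarith)
  have h6 : 0 < b * K * lam0 / (m * (η + ε)) := by positivity
  exact mul_lt_mul h3 h4 h5 (by linarith)
end
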